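/- Let u0, u1, u2 ∈ K[t0,t1] be homogeneous of the same degree d ≥ 1 with gcd 1, over a field K. Then the syzygy module Syz(u0,u1,u2) = {(v0,v1,v2) ∈ K[t0,t1]^3 : v0u0 + v1u1 + v2u2 = 0} is a free graded K[t0,t1]-module of rank 2, generated by homogeneous elements of degrees μ and d-μ for some unique μ with 0 ≤ μ ≤ d/2. -/

import Mathlib

open MvPolynomial

section helpers

variable {K : Type*} [Field K]

attribute [local instance] MvPolynomial.gradedAlgebra

theorem aux_comp_mul {a b : MvPolynomial (Fin 2) K} {m : ℕ} (hb : b.IsHomogeneous m) (n : ℕ) :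
    homogeneousComponent (n + m) (a * b) = homogeneousComponent n a * b := by
  rw [← decomposition.decompose'_apply, ← decomposition.decompose'_apply]
  exact DirectSum.coe_decompose_mul_add_of_right_mem (homogeneousSubmodule (Fin 2) K)
    (a := a) (b := b) (i := n) (j := m) hb

theorem aux_comp_mul_lt {a b : MvPolynomial (Fin 2) K} {m n : ℕ} (hb : b.IsHomogeneous m)
    (h : n < m) : homogeneousComponent n (a * b) = 0 := by
  rw [← decomposition.decompose'_apply]
  exact DirectSum.coe_decompose_mul_of_right_mem_of_not_le (homogeneousSubmodule (Fin 2) K)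
    (a := a) (b := b) (n := n) (i := m) hb (by omega)

/-- A vector parallel to a vector with unit gcd is a multiple of it. -/
theorem aux_parallel (u w : Fin 3 → MvPolynomial (Fin 2) K)
    (hgcd : ∀ p : MvPolynomial (Fin 2) K, (∀ i, p ∣ u i) → IsUnit p)
    (h : ∀ i j, w i * u j = w j * u i) : ∃ c, ∀ i, w i = c * u i := by
  classical
  let : NormalizedGCDMonoid (MvPolynomial (Fin 2) K) := Classical.arbitrary _
  have hne : ∃ j, u j ≠ 0 := by
    by_contra! hz
    have := hgcd 0 (fun i => by simp [hz i])
    exact not_isUnit_zero this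
  obtain ⟨j, hj⟩ := hne
  have hg : IsUnit (Finset.univ.gcd u) := hgcd _ (fun i => Finset.gcd_dvd (Finset.mem_univ i))
  have h1 : u j ∣ w j * Finset.univ.gcd u := by
    refine dvd_trans (Finset.dvd_gcd (fun i _ => ?_)) (Finset.gcd_mul_left' (s := Finset.univ) (f := u) (w j)).dvd
    exact ⟨w i, by rw [← h i j, mul_comm]⟩
  rw [hg.dvd_mul_right] at h1
  obtain ⟨c, hc⟩ := h1
  refine ⟨c, fun i => mul_right_cancel₀ hj ?_⟩
  rw [h i j, hc]; ring

theorem aux_finrank (n : ℕ) : Module.Finite K (homogeneousSubmodule (Fin 2) K n) ∧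
    Module.finrank K (homogeneousSubmodule (Fin 2) K n) = n + 1 := by
  rw [homogeneousSubmodule_eq_finsupp_supported]
  let e : ({d : Fin 2 →₀ ℕ | d.degree = n} : Set _) ≃ Fin (n + 1) :=
    { toFun := fun d => ⟨d.1 0, by
        have := d.2
        simp only [Set.mem_ofPred_eq, Finsupp.degree_eq_sum, Fin.sum_univ_two] at this
        omega⟩
      invFun := fun i => ⟨Finsupp.equivFunOnFinite.symm ![i.1, n - i.1], by
        simp [Finsupp.degree_eq_sum, Fin.sum_univ_two]; omega⟩
      left_inv := by
        rintro ⟨d, hd⟩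
        simp only [Set.mem_ofPred_eq, Finsupp.degree_eq_sum, Fin.sum_univ_two] at hd
        ext i
        fin_cases i
        · simp
        · simp; omega
      right_inv := by
        intro i; ext; simp }
  let E := (AddMonoidAlgebra.supportedEquivFinsupp (R := K) (S := K) {d : Fin 2 →₀ ℕ | d.degree = n}).trans
    ((Finsupp.domLCongr e).trans (Finsupp.linearEquivFunOnFinite K K (Fin (n+1))))
  exact ⟨Module.Finite.equiv E.symm, by rw [E.finrank_eq]; simp⟩

instance aux_fin (n : ℕ) : Module.Finite K (homogeneousSubmodule (Fin 2) K n) := (aux_finrank n).1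

/-- The degree n syzygy map. -/
noncomputable def auxMap (d n : ℕ) (u : Fin 3 → MvPolynomial (Fin 2) K) (hu : ∀ i, (u i).IsHomogeneous d) :
    (Fin 3 → homogeneousSubmodule (Fin 2) K n) →ₗ[K] homogeneousSubmodule (Fin 2) K (n + d) where
  toFun v := ⟨∑ i, (v i : MvPolynomial (Fin 2) K) * u i,
    Submodule.sum_mem _ fun i _ => IsHomogeneous.mul (v i).2 (hu i)⟩
  map_add' v w := by ext1; simp [add_mul, Finset.sum_add_distrib]
  map_smul' c v := by ext1; simp [Finset.smul_sum]

/-- The map of multiplication of `p`. -/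
noncomputable def auxMul (m n : ℕ) (p : Fin 3 → MvPolynomial (Fin 2) K) (hp : ∀ i, (p i).IsHomogeneous m) :
    homogeneousSubmodule (Fin 2) K n →ₗ[K] (Fin 3 → homogeneousSubmodule (Fin 2) K (n + m)) where
  toFun r := fun i => ⟨r * p i, IsHomogeneous.mul r.2 (hp i)⟩
  map_add' v w := by ext1 i; ext1; simp [add_mul]
  map_smul' c v := by ext1 i; ext1; simp

theorem aux_dim_ker (d n : ℕ) (u : Fin 3 → MvPolynomial (Fin 2) K) (hu : ∀ i, (u i).IsHomogeneous d) :
    2 * n + 2 ≤ Module.finrank K (LinearMap.ker (auxMap d n u hu)) + d := by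
  have h := (auxMap d n u hu).finrank_range_add_finrank_ker
  have h2 := Submodule.finrank_le (LinearMap.range (auxMap d n u hu))
  rw [(aux_finrank _).2] at h2
  rw [Module.finrank_pi_fintype] at h
  simp only [(aux_finrank _).2, Finset.sum_const, Finset.card_univ, Fintype.card_fin, smul_eq_mul] at h
  omega

theorem aux_exists_p (d n : ℕ) (hn : d ≤ 2 * n + 1) (u : Fin 3 → MvPolynomial (Fin 2) K)
    (hu : ∀ i, (u i).IsHomogeneous d) :
    ∃ p : Fin 3 → MvPolynomial (Fin 2) K, (∀ i, (p i).IsHomogeneous n) ∧ p ≠ 0 ∧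
      ∑ i, p i * u i = 0 := by
  have h := aux_dim_ker d n u hu
  have hne : LinearMap.ker (auxMap d n u hu) ≠ ⊥ := by
    intro h0
    rw [h0, finrank_bot] at h
    omega
  obtain ⟨v, hv, hv0⟩ := Submodule.exists_mem_ne_zero_of_ne_bot hne
  refine ⟨fun i => v i, fun i => (v i).2, fun h0 => hv0 ?_, ?_⟩
  · ext1 i; ext1; exact congrFun h0 i
  · exact congrArg Subtype.val (LinearMap.mem_ker.1 hv)

theorem aux_exists_q (d m : ℕ) (hm : 2 * m ≤ d) (u : Fin 3 → MvPolynomial (Fin 2) K)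
    (hu : ∀ i, (u i).IsHomogeneous d) (p : Fin 3 → MvPolynomial (Fin 2) K)
    (hp : ∀ i, (p i).IsHomogeneous m) :
    ∃ q : Fin 3 → MvPolynomial (Fin 2) K, (∀ i, (q i).IsHomogeneous (d - m)) ∧
      ∑ i, q i * u i = 0 ∧ ¬ ∃ r, ∀ i, q i = r * p i := by
  obtain ⟨e, rfl⟩ := Nat.exists_eq_add_of_le hm
  have hd : 2 * m + e - m = e + m := by omega
  rw [hd]
  have h := aux_dim_ker _ (e + m) u hu
  by_contra! hcon
  have hle : LinearMap.ker (auxMap _ (e + m) u hu) ≤ LinearMap.range (auxMul m e p hp) := by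
    intro v hv
    obtain ⟨r, hr⟩ := hcon (fun i => v i) (fun i => (v i).2)
      (congrArg Subtype.val (LinearMap.mem_ker.1 hv))
    refine ⟨⟨homogeneousComponent e r, homogeneousComponent_isHomogeneous _ _⟩, ?_⟩
    ext1 i; ext1
    change homogeneousComponent e r * p i = v i
    rw [← aux_comp_mul (hp i), ← hr i]
    exact homogeneousComponent_eq_self (v i).2
  have h1 := Submodule.finrank_mono hle
  have h2 := LinearMap.finrank_range_le (auxMul m e p hp)
  rw [(aux_finrank _).2] at h2
  omega

theorem aux_comp_syz {d : ℕ} {u : Fin 3 → MvPolynomial (Fin 2) K}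
    (hu : ∀ i, (u i).IsHomogeneous d) {v : Fin 3 → MvPolynomial (Fin 2) K}
    (hv : ∑ i, v i * u i = 0) (n : ℕ) : ∑ i, homogeneousComponent n (v i) * u i = 0 := by
  have := congrArg (homogeneousComponent (n + d)) hv
  rw [map_sum, map_zero] at this
  rw [← this]
  exact Finset.sum_congr rfl fun i _ => (aux_comp_mul (hu i) n).symm

theorem aux_gcd_p {d m : ℕ} {u : Fin 3 → MvPolynomial (Fin 2) K}
    (hu : ∀ i, (u i).IsHomogeneous d) {p : Fin 3 → MvPolynomial (Fin 2) K}
    (hp : ∀ i, (p i).IsHomogeneous m) (hp0 : p ≠ 0) (hs : ∑ i, p i * u i = 0)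
    (hmin : ∀ (n : ℕ) (v : Fin 3 → MvPolynomial (Fin 2) K), (∀ i, (v i).IsHomogeneous n) →
      v ≠ 0 → ∑ i, v i * u i = 0 → m ≤ n) :
    ∀ g : MvPolynomial (Fin 2) K, (∀ i, g ∣ p i) → IsUnit g := by
  intro g hg
  choose v hv using hg
  obtain ⟨j, hj⟩ := Function.ne_iff.1 hp0
  simp only [Pi.zero_apply] at hj
  have hg0 : g ≠ 0 := by rintro rfl; apply hj; rw [hv]; simp
  have hvj : v j ≠ 0 := by intro h0; apply hj; rw [hv, h0]; simp
  have hvs : ∑ i, v i * u i = 0 := by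
    apply mul_left_cancel₀ hg0
    rw [Finset.mul_sum, mul_zero, ← hs]
    exact Finset.sum_congr rfl fun i _ => by rw [hv i]; ring
  have hdeg := (hp j).totalDegree hj
  rw [hv j, totalDegree_mul_of_isDomain hg0 hvj] at hdeg
  have hex : ∃ n ≤ (v j).totalDegree, homogeneousComponent n (v j) ≠ 0 := by
    by_contra! hcon
    apply hvj
    rw [← sum_homogeneousComponent (v j)]
    exact Finset.sum_eq_zero fun i hi => hcon i (by simp at hi; omega)
  obtain ⟨n, hn, hnj⟩ := hex
  have := hmin n (fun i => homogeneousComponent n (v i))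
    (fun i => homogeneousComponent_isHomogeneous _ _) (fun h0 => hnj (congrFun h0 j))
    (aux_comp_syz hu hvs n)
  have hg1 : g.totalDegree = 0 := by omega
  rw [totalDegree_eq_zero_iff_eq_C] at hg1
  rw [hg1]
  refine IsUnit.map C (isUnit_iff_ne_zero.2 ?_)
  intro h0; rw [h0] at hg1; simp at hg1; exact hg0 hg1

/-- Two syzygies of a coprime vector have cross product a multiple of that vector. -/
theorem aux_cross {u : Fin 3 → MvPolynomial (Fin 2) K}
    (hgcd : ∀ p : MvPolynomial (Fin 2) K, (∀ i, p ∣ u i) → IsUnit p)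
    {p q : Fin 3 → MvPolynomial (Fin 2) K}
    (hp : ∑ i, p i * u i = 0) (hq : ∑ i, q i * u i = 0) :
    ∃ c, p 1 * q 2 - p 2 * q 1 = c * u 0 ∧ p 2 * q 0 - p 0 * q 2 = c * u 1 ∧
      p 0 * q 1 - p 1 * q 0 = c * u 2 := by
  simp only [Fin.sum_univ_three] at hp hq
  have h01 : (p 1 * q 2 - p 2 * q 1) * u 1 = (p 2 * q 0 - p 0 * q 2) * u 0 := by
    linear_combination q 2 * hp - p 2 * hq
  have h02 : (p 1 * q 2 - p 2 * q 1) * u 2 = (p 0 * q 1 - p 1 * q 0) * u 0 := by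
    linear_combination p 1 * hq - q 1 * hp
  have h12 : (p 2 * q 0 - p 0 * q 2) * u 2 = (p 0 * q 1 - p 1 * q 0) * u 1 := by
    linear_combination q 0 * hp - p 0 * hq
  obtain ⟨c, hc⟩ := aux_parallel u
    ![p 1 * q 2 - p 2 * q 1, p 2 * q 0 - p 0 * q 2, p 0 * q 1 - p 1 * q 0] hgcd (by
      intro i j
      fin_cases i <;> fin_cases j <;> simp [h01, h02, h12])
  exact ⟨c, hc 0, hc 1, hc 2⟩

theorem aux_ring00 {R : Type*} [CommRing R] {p0 p1 p2 q0 q1 q2 w0 w1 w2 : R}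
    (wq0 : w1 * q2 = w2 * q1) (wq1 : w2 * q0 = w0 * q2) (wq2 : w0 * q1 = w1 * q0)
    (pw0 : p1 * w2 = p2 * w1) (pw1 : p2 * w0 = p0 * w2) (pw2 : p0 * w1 = p1 * w0) :
    w0 * (p1 * q2 - p2 * q1) = 0 := by
  grind

theorem aux_ring01 {R : Type*} [CommRing R] {p0 p1 p2 q0 q1 q2 w0 w1 w2 : R}
    (wq0 : w1 * q2 = w2 * q1) (wq1 : w2 * q0 = w0 * q2) (wq2 : w0 * q1 = w1 * q0)
    (pw0 : p1 * w2 = p2 * w1) (pw1 : p2 * w0 = p0 * w2) (pw2 : p0 * w1 = p1 * w0) :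
    w1 * (p1 * q2 - p2 * q1) = 0 := by
  grind

theorem aux_ring02 {R : Type*} [CommRing R] {p0 p1 p2 q0 q1 q2 w0 w1 w2 : R}
    (wq0 : w1 * q2 = w2 * q1) (wq1 : w2 * q0 = w0 * q2) (wq2 : w0 * q1 = w1 * q0)
    (pw0 : p1 * w2 = p2 * w1) (pw1 : p2 * w0 = p0 * w2) (pw2 : p0 * w1 = p1 * w0) :
    w2 * (p1 * q2 - p2 * q1) = 0 := by
  grind

theorem aux_ring10 {R : Type*} [CommRing R] {p0 p1 p2 q0 q1 q2 w0 w1 w2 : R}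
    (wq0 : w1 * q2 = w2 * q1) (wq1 : w2 * q0 = w0 * q2) (wq2 : w0 * q1 = w1 * q0)
    (pw0 : p1 * w2 = p2 * w1) (pw1 : p2 * w0 = p0 * w2) (pw2 : p0 * w1 = p1 * w0) :
    w0 * (p2 * q0 - p0 * q2) = 0 := by
  grind

theorem aux_ring11 {R : Type*} [CommRing R] {p0 p1 p2 q0 q1 q2 w0 w1 w2 : R}
    (wq0 : w1 * q2 = w2 * q1) (wq1 : w2 * q0 = w0 * q2) (wq2 : w0 * q1 = w1 * q0)
    (pw0 : p1 * w2 = p2 * w1) (pw1 : p2 * w0 = p0 * w2) (pw2 : p0 * w1 = p1 * w0) :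
    w1 * (p2 * q0 - p0 * q2) = 0 := by
  grind

theorem aux_ring12 {R : Type*} [CommRing R] {p0 p1 p2 q0 q1 q2 w0 w1 w2 : R}
    (wq0 : w1 * q2 = w2 * q1) (wq1 : w2 * q0 = w0 * q2) (wq2 : w0 * q1 = w1 * q0)
    (pw0 : p1 * w2 = p2 * w1) (pw1 : p2 * w0 = p0 * w2) (pw2 : p0 * w1 = p1 * w0) :
    w2 * (p2 * q0 - p0 * q2) = 0 := by
  grind

theorem aux_ring20 {R : Type*} [CommRing R] {p0 p1 p2 q0 q1 q2 w0 w1 w2 : R}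
    (wq0 : w1 * q2 = w2 * q1) (wq1 : w2 * q0 = w0 * q2) (wq2 : w0 * q1 = w1 * q0)
    (pw0 : p1 * w2 = p2 * w1) (pw1 : p2 * w0 = p0 * w2) (pw2 : p0 * w1 = p1 * w0) :
    w0 * (p0 * q1 - p1 * q0) = 0 := by
  grind

theorem aux_ring21 {R : Type*} [CommRing R] {p0 p1 p2 q0 q1 q2 w0 w1 w2 : R}
    (wq0 : w1 * q2 = w2 * q1) (wq1 : w2 * q0 = w0 * q2) (wq2 : w0 * q1 = w1 * q0)
    (pw0 : p1 * w2 = p2 * w1) (pw1 : p2 * w0 = p0 * w2) (pw2 : p0 * w1 = p1 * w0) :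
    w1 * (p0 * q1 - p1 * q0) = 0 := by
  grind

theorem aux_ring22 {R : Type*} [CommRing R] {p0 p1 p2 q0 q1 q2 w0 w1 w2 : R}
    (wq0 : w1 * q2 = w2 * q1) (wq1 : w2 * q0 = w0 * q2) (wq2 : w0 * q1 = w1 * q0)
    (pw0 : p1 * w2 = p2 * w1) (pw1 : p2 * w0 = p0 * w2) (pw2 : p0 * w1 = p1 * w0) :
    w2 * (p0 * q1 - p1 * q0) = 0 := by
  grind

end helpers


/-- The syzygy module of three coprime homogeneous binary forms of degree d ≥ 1
is free graded of rank 2, generated in degrees μ and d-μ for a unique μ ≤ d/2. -/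
theorem stmt_6 (K : Type*) [Field K] (d : ℕ) (hd : 1 ≤ d)
    (u : Fin 3 → MvPolynomial (Fin 2) K)
    (hu : ∀ i, (u i).IsHomogeneous d)
    (hgcd : ∀ p : MvPolynomial (Fin 2) K, (∀ i, p ∣ u i) → IsUnit p) :
    ∃ μ : ℕ, 2 * μ ≤ d ∧
      (∃ p q : Fin 3 → MvPolynomial (Fin 2) K,
        (∀ i, (p i).IsHomogeneous μ) ∧ (∀ i, (q i).IsHomogeneous (d - μ)) ∧
        (∑ i, p i * u i = 0) ∧ (∑ i, q i * u i = 0) ∧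
        ∀ v : Fin 3 → MvPolynomial (Fin 2) K, (∑ i, v i * u i = 0) →
          ∃! ab : MvPolynomial (Fin 2) K × MvPolynomial (Fin 2) K,
            ∀ i, v i = ab.1 * p i + ab.2 * q i) ∧
      -- uniqueness of μ: any other pair of homogeneous generating degrees μ' ≤ d/2
      -- coincides with μ
      (∀ μ' : ℕ, 2 * μ' ≤ d →
        (∃ p q : Fin 3 → MvPolynomial (Fin 2) K,
          (∀ i, (p i).IsHomogeneous μ') ∧ (∀ i, (q i).IsHomogeneous (d - μ')) ∧
          (∑ i, p i * u i = 0) ∧ (∑ i, q i * u i = 0) ∧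
          ∀ v : Fin 3 → MvPolynomial (Fin 2) K, (∑ i, v i * u i = 0) →
            ∃ a b : MvPolynomial (Fin 2) K, ∀ i, v i = a * p i + b * q i) →
        μ' = μ) := by
  classical
  have hex : ∃ n, ∃ p : Fin 3 → MvPolynomial (Fin 2) K, (∀ i, (p i).IsHomogeneous n) ∧ p ≠ 0 ∧
      ∑ i, p i * u i = 0 := ⟨d / 2, aux_exists_p d (d / 2) (by omega) u hu⟩
  obtain ⟨p, hp, hp0, hps⟩ := Nat.find_spec hex
  have hm2 : Nat.find hex ≤ d / 2 := Nat.find_min' hex (aux_exists_p d (d / 2) (by omega) u hu)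
  have hmin : ∀ (n : ℕ) (v : Fin 3 → MvPolynomial (Fin 2) K), (∀ i, (v i).IsHomogeneous n) →
      v ≠ 0 → ∑ i, v i * u i = 0 → Nat.find hex ≤ n :=
    fun n v h1 h2 h3 => Nat.find_min' hex ⟨v, h1, h2, h3⟩
  generalize Nat.find hex = m at *
  have hm : 2 * m ≤ d := by omega
  obtain ⟨q, hq, hqs, hqp⟩ := aux_exists_q d m hm u hu p hp
  have hpg := aux_gcd_p hu hp hp0 hps hmin
  obtain ⟨c, hc0, hc1, hc2⟩ := aux_cross hgcd hps hqs
  have hcr : c ≠ 0 := by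
    rintro rfl
    apply hqp
    apply aux_parallel p q hpg
    rw [zero_mul] at hc0 hc1 hc2
    intro i j
    fin_cases i <;> fin_cases j <;> simp <;> grind
  -- some coordinate of `u` is nonzero
  have hune : ∃ j, u j ≠ 0 := by
    by_contra! hz
    exact not_isUnit_zero (hgcd 0 (fun i => by simp [hz i]))
  obtain ⟨j, hj⟩ := hune
  -- `c` is constant
  have hdm : m + (d - m) = d := by omega
  have hpq : ∀ i k, (p i * q k).IsHomogeneous d := fun i k => by
    have := (hp i).mul (hq k)
    rwa [hdm] at this
  have hcu : ∀ i, (c * u i).IsHomogeneous d := by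
    intro i
    fin_cases i
    · simp only [Fin.zero_eta]; rw [← hc0]; exact (hpq _ _).sub (hpq _ _)
    · simp only [Fin.mk_one]; rw [← hc1]; exact (hpq _ _).sub (hpq _ _)
    · simp only [Fin.reduceFinMk]; rw [← hc2]; exact (hpq _ _).sub (hpq _ _)
  have hcdeg : c.totalDegree = 0 := by
    have h1 := (hcu j).totalDegree (mul_ne_zero hcr hj)
    rw [totalDegree_mul_of_isDomain hcr hj, (hu j).totalDegree hj] at h1
    omega
  have hcunit : IsUnit c := by
    rw [totalDegree_eq_zero_iff_eq_C] at hcdeg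
    rw [hcdeg]
    refine IsUnit.map C (isUnit_iff_ne_zero.2 ?_)
    intro h0; rw [h0] at hcdeg; simp at hcdeg; exact hcr hcdeg
  -- if `a p + b q = 0` then `a = b = 0`
  have hind : ∀ a b : MvPolynomial (Fin 2) K, (∀ i, a * p i + b * q i = 0) → a = 0 ∧ b = 0 := by
    intro a b h
    have h0 := h 0
    have h1 := h 1
    have h2 := h 2
    have hA : ∀ i, a * (c * u i) = 0 := by
      intro i
      fin_cases i
      · simp only [Fin.zero_eta]; rw [← hc0]; linear_combination q 2 * h1 - q 1 * h2
      · simp only [Fin.mk_one]; rw [← hc1]; linear_combination q 0 * h2 - q 2 * h0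
      · simp only [Fin.reduceFinMk]; rw [← hc2]; linear_combination q 1 * h0 - q 0 * h1
    have hB : ∀ i, b * (c * u i) = 0 := by
      intro i
      fin_cases i
      · simp only [Fin.zero_eta]; rw [← hc0]; linear_combination p 1 * h2 - p 2 * h1
      · simp only [Fin.mk_one]; rw [← hc1]; linear_combination p 2 * h0 - p 0 * h2
      · simp only [Fin.reduceFinMk]; rw [← hc2]; linear_combination p 0 * h1 - p 1 * h0
    have hne := mul_ne_zero hcr hj
    exact ⟨(mul_eq_zero.1 (hA j)).resolve_right hne, (mul_eq_zero.1 (hB j)).resolve_right hne⟩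
  refine ⟨m, hm, ⟨p, q, hp, hq, hps, hqs, ?_⟩, ?_⟩
  · intro v hv
    obtain ⟨a, ha0, ha1, ha2⟩ := aux_cross hgcd hv hqs
    obtain ⟨b, hb0, hb1, hb2⟩ := aux_cross hgcd hps hv
    obtain ⟨c', hc'⟩ := hcunit.exists_left_inv
    have key : ∀ i, c * v i = a * p i + b * q i := by
      -- `w = c v - a p - b q` has zero cross product with `p` and `q`
      obtain ⟨w, hw⟩ : ∃ w : Fin 3 → MvPolynomial (Fin 2) K,
        ∀ i, w i = c * v i - a * p i - b * q i := ⟨_, fun _ => rfl⟩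
      have w0 := hw 0
      have w1 := hw 1
      have w2 := hw 2
      have wq0 : w 1 * q 2 = w 2 * q 1 := by
        rw [w1, w2]; linear_combination c * ha0 - a * hc0
      have wq1 : w 2 * q 0 = w 0 * q 2 := by
        rw [w0, w2]; linear_combination c * ha1 - a * hc1
      have wq2 : w 0 * q 1 = w 1 * q 0 := by
        rw [w0, w1]; linear_combination c * ha2 - a * hc2
      have pw0 : p 1 * w 2 = p 2 * w 1 := by
        rw [w1, w2]; linear_combination c * hb0 - b * hc0
      have pw1 : p 2 * w 0 = p 0 * w 2 := by
        rw [w0, w2]; linear_combination c * hb1 - b * hc1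
      have pw2 : p 0 * w 1 = p 1 * w 0 := by
        rw [w0, w1]; linear_combination c * hb2 - b * hc2
      have hz : ∀ i k, w i * (c * u k) = 0 := by
        intro i k
        fin_cases k
        · simp only [Fin.zero_eta]; rw [← hc0]; fin_cases i
          · exact aux_ring00 wq0 wq1 wq2 pw0 pw1 pw2
          · exact aux_ring01 wq0 wq1 wq2 pw0 pw1 pw2
          · exact aux_ring02 wq0 wq1 wq2 pw0 pw1 pw2
        · simp only [Fin.mk_one]; rw [← hc1]; fin_cases i
          · exact aux_ring10 wq0 wq1 wq2 pw0 pw1 pw2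
          · exact aux_ring11 wq0 wq1 wq2 pw0 pw1 pw2
          · exact aux_ring12 wq0 wq1 wq2 pw0 pw1 pw2
        · simp only [Fin.reduceFinMk]; rw [← hc2]; fin_cases i
          · exact aux_ring20 wq0 wq1 wq2 pw0 pw1 pw2
          · exact aux_ring21 wq0 wq1 wq2 pw0 pw1 pw2
          · exact aux_ring22 wq0 wq1 wq2 pw0 pw1 pw2
      intro i
      have := (mul_eq_zero.1 (hz i j)).resolve_right (mul_ne_zero hcr hj)
      rw [hw] at this
      linear_combination this
    have hsol : ∀ i, v i = (c' * a) * p i + (c' * b) * q i := fun i => by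
      linear_combination c' * key i - v i * hc'
    refine ⟨(c' * a, c' * b), hsol, ?_⟩
    rintro ⟨a', b'⟩ h'
    simp only at h'
    obtain ⟨e1, e2⟩ := hind (a' - c' * a) (b' - c' * b) (fun i => by
      linear_combination hsol i - h' i)
    rw [sub_eq_zero.1 e1, sub_eq_zero.1 e2]
  · rintro m' hm' ⟨p', q', hp', hq', hps', hqs', hgen⟩
    apply le_antisymm
    · by_contra! hlt
      apply hp0
      obtain ⟨a, b, hab⟩ := hgen p hps
      ext1 i
      rw [Pi.zero_apply, ← homogeneousComponent_eq_self (hp i), hab i, map_add,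
        aux_comp_mul_lt (hp' i) hlt, aux_comp_mul_lt (hq' i) (by omega), add_zero]
    · refine hmin m' p' hp' ?_ hps'
      rintro rfl
      obtain ⟨a, b, hab⟩ := hgen p hps
      obtain ⟨a', b', hab'⟩ := hgen q hqs
      obtain ⟨e1, e2⟩ := hind b' (-b) (fun i => by rw [hab i, hab' i]; simp; ring)
      apply hp0
      ext1 i
      rw [hab i, neg_eq_zero.1 e2]; simp
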